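/- arXiv:0710.2994 — 6 statements merged into one kernel-verified Lean document; each statement's English description precedes it below -/
import Mathlib

section
/- Let q ≥ 2 be an integer and let Φ be the linear operator on functions f : ℕ → ℂ defined by (Φf)(0) = (q+1)·f(1) and (Φf)(n) = q·f(n−1) + f(n+1) for all n ≥ 1. If f : ℕ → ℂ satisfies (Φ^k f)(0) = 0 for every integer k ≥ 0, then f = 0. -/
/-- If an unramified automorphic form `f` on the quotient Bruhat–Tits graph of `P¹`
satisfies `(Φ^k f)(c₀) = 0` for all `k ≥ 0`, where `Φ` is the Hecke operator
`(Φf)(0) = (q+1)·f(1)`, `(Φf)(n) = q·f(n−1) + f(n+1)` for `n ≥ 1`, then `f = 0`. -/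
theorem stmt_0 (q : ℕ) (hq : 2 ≤ q) (Φ : (ℕ → ℂ) → (ℕ → ℂ))
    (hΦ0 : ∀ f : ℕ → ℂ, Φ f 0 = (q + 1) * f 1)
    (hΦ : ∀ (f : ℕ → ℂ) (n : ℕ), 1 ≤ n → Φ f n = q * f (n - 1) + f (n + 1))
    (f : ℕ → ℂ) (hf : ∀ k : ℕ, (Φ^[k] f) 0 = 0) :
    f = 0 := by
  have key : ∀ (n : ℕ) (g : ℕ → ℂ), (∀ k : ℕ, (Φ^[k] g) 0 = 0) → g n = 0 := by
    intro n
    induction n using Nat.twoStepInduction with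
    | zero => exact fun g hg => hg 0
    | one =>
      intro g hg
      have h : Φ g 0 = 0 := hg 1
      rw [hΦ0] at h
      exact (mul_eq_zero.mp h).resolve_left (Nat.cast_add_one_ne_zero q)
    | more n ih₀ ih₁ =>
      intro g hg
      have h : Φ g (n + 1) = 0 := ih₁ (Φ g) fun k => hg (k + 1)
      rw [hΦ g (n + 1) (Nat.le_add_left 1 n), Nat.add_sub_cancel, ih₀ g hg, mul_zero,
        zero_add] at h
      exact h
  exact funext fun n => key n f hf
end

section
/- Let K be a finite field with 4 elements and let α ∈ K satisfy α² + α + 1 = 0 (equivalently, α ∉ {0,1}). Then the Weierstrass curve W over K defined by y² + y = x³ + α (coefficients a₁ = 0, a₂ = 0, a₃ = 1, a₄ = 0, a₆ = α) has exactly one K-rational point, namely the point at infinity: Nat.card W.Point = 1. -/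
/-- Let `K` be a finite field with 4 elements and `α ∈ K` with `α² + α + 1 = 0`.
The Weierstrass curve `y² + y = x³ + α` over `K` has exactly one `K`-rational
point (the point at infinity). -/
theorem stmt_4 (K : Type*) [Field K] [Fintype K] (hK : Fintype.card K = 4)
    (α : K) (hα : α ^ 2 + α + 1 = 0)
    (W : WeierstrassCurve K)
    (hW : W = { a₁ := 0, a₂ := 0, a₃ := 1, a₄ := 0, a₆ := α }) :
    Nat.card W.toAffine.Point = 1 := by
  subst hW
  have four_eq_zero : (4 : K) = 0 := by simpa [hK] using Nat.cast_card_eq_zero K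
  have two_eq_zero : (2 : K) = 0 := by
    refine pow_eq_zero_iff two_ne_zero |>.mp ?_
    linear_combination four_eq_zero
  have pow_four (z : K) : z ^ 4 = z := hK ▸ FiniteField.pow_card z
  rw [Nat.card_eq_one_iff_unique]
  refine ⟨⟨?_⟩, ⟨.zero⟩⟩
  suffices h : ∀ P : WeierstrassCurve.Affine.Point
      (WeierstrassCurve.toAffine { a₁ := 0, a₂ := 0, a₃ := 1, a₄ := 0, a₆ := α }), P = .zero from
    fun P Q => (h P).trans (h Q).symm
  rintro (_ | ⟨x, y, hxy⟩)
  · rfl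
  · have hE := (WeierstrassCurve.Affine.equation_iff x y).mp hxy.1
    simp only [zero_mul, one_mul, add_zero] at hE
    refine absurd ?_ (one_ne_zero (α := K))
    linear_combination hα + x ^ 2 * pow_four x + two_eq_zero * (x ^ 3 + α * x ^ 3)
      + hE * (y ^ 2 + y + x ^ 3 + α + 1) - pow_four y - two_eq_zero * (y + y ^ 2 + y ^ 3)
end

section
/- Let q ∈ {2, 3, 4} and let s ∈ ℂ. If q^s + q^{1−s} ∈ {0, q, −q} (complex powers of the positive real number q), then Re(s) = 1/2. -/
/-- A complex root of a monic real quadratic polynomial `z² - a z + b` with nonpositive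
discriminant satisfies `|z|² = b`. -/
theorem Complex.normSq_eq_of_quadratic {a b : ℝ} (hab : a ^ 2 ≤ 4 * b) {z : ℂ}
    (hz : z ^ 2 + b = a * z) : Complex.normSq z = b := by
  have hre := congrArg Complex.re hz
  have him := congrArg Complex.im hz
  simp only [pow_two, Complex.add_re, Complex.add_im, Complex.mul_re, Complex.mul_im,
    Complex.ofReal_re, Complex.ofReal_im] at hre him
  rw [Complex.normSq_apply]
  have hprod : z.im * (2 * z.re - a) = 0 := by linarith
  rcases mul_eq_zero.mp hprod with him0 | hre0
  · rw [him0] at hre ⊢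
    have hdisc : (2 * z.re - a) ^ 2 = 0 := by nlinarith [sq_nonneg (2 * z.re - a)]
    have ha : a = 2 * z.re := by linarith [pow_eq_zero_iff (two_ne_zero) |>.mp hdisc]
    subst ha
    linarith
  · have ha : a = 2 * z.re := by linarith
    subst ha
    linarith

/-- If `q > 1` and `q^s + q^(1-s)` is a real number `a` with `a² ≤ 4q`, then `Re(s) = 1/2`. -/
theorem Complex.re_eq_half_of_cpow_add_cpow_one_sub {q : ℝ} (hq : 1 < q) {a : ℝ}
    (ha : a ^ 2 ≤ 4 * q) {s : ℂ} (h : (q : ℂ) ^ s + (q : ℂ) ^ (1 - s) = a) :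
    s.re = 1 / 2 := by
  have hq0 : 0 < q := by linarith
  have hqc : (q : ℂ) ≠ 0 := Complex.ofReal_ne_zero.mpr hq0.ne'
  have hz : ((q : ℂ) ^ s) ^ 2 + q = a * (q : ℂ) ^ s := by
    have hmul : (q : ℂ) ^ (1 - s) * (q : ℂ) ^ s = q := by
      rw [← Complex.cpow_add _ _ hqc, sub_add_cancel, Complex.cpow_one]
    rw [← h, add_mul, hmul, pow_two]
  have hnorm := Complex.normSq_eq_of_quadratic ha hz
  rw [Complex.normSq_eq_norm_sq, Complex.norm_cpow_eq_rpow_re_of_pos hq0] at hnorm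
  have hlog := congrArg Real.log hnorm
  rw [Real.log_pow, Real.log_rpow hq0] at hlog
  have hlog0 : Real.log q ≠ 0 := (Real.log_pos hq).ne'
  push_cast at hlog
  have : 2 * s.re = 1 := mul_right_cancel₀ hlog0 (by linarith)
  linarith

open Complex in
/-- For `q ∈ {2, 3, 4}` and `s ∈ ℂ`, if the Hecke eigenvalue `q^s + q^(1−s)` lies in
`{0, q, −q}`, then `Re(s) = 1/2`. -/
theorem stmt_12 (q : ℕ) (hq : q ∈ ({2, 3, 4} : Set ℕ)) (s : ℂ)
    (h : (q : ℂ) ^ s + (q : ℂ) ^ (1 - s) ∈ ({0, (q : ℂ), -(q : ℂ)} : Set ℂ)) :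
    s.re = 1 / 2 := by
  obtain ⟨hq1, hq4⟩ : 1 < q ∧ q ≤ 4 := by
    rcases hq with rfl | rfl | rfl <;> norm_num
  have hq1' : (1 : ℝ) < q := by exact_mod_cast hq1
  have hq4' : (q : ℝ) ≤ 4 := by exact_mod_cast hq4
  rcases h with h | h | h
  · exact re_eq_half_of_cpow_add_cpow_one_sub (q := q) (a := 0) hq1' (by linarith)
      (by simpa using h)
  · exact re_eq_half_of_cpow_add_cpow_one_sub (q := q) (a := q) hq1' (by nlinarith)
      (by simpa using h)
  · exact re_eq_half_of_cpow_add_cpow_one_sub (q := q) (a := -q) hq1' (by nlinarith)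
      (by simpa using h)
end

section
/- Let q ∈ {2, 3, 4} and let s ∈ ℂ. If q^{1−2s} − q^{1−s} + 1 = 0 (complex powers of the positive real number q), then Re(s) = 1/2. -/
/-- If `0 < a ≤ 4`, the roots of `a w² - a w + 1` lie on the circle `|w|² = a⁻¹`. -/
theorem mul_normSq_eq_one_of_quadratic_eq_zero {a : ℝ} (ha : 0 < a) (ha4 : a ≤ 4) {w : ℂ}
    (h : (a : ℂ) * w ^ 2 - a * w + 1 = 0) : a * Complex.normSq w = 1 := by
  have hre := congrArg Complex.re h
  have him := congrArg Complex.im h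
  simp only [pow_two, Complex.add_re, Complex.sub_re, Complex.mul_re, Complex.mul_im,
    Complex.ofReal_re, Complex.ofReal_im, Complex.one_re, Complex.zero_re] at hre
  simp only [pow_two, Complex.add_im, Complex.sub_im, Complex.mul_re, Complex.mul_im,
    Complex.ofReal_re, Complex.ofReal_im, Complex.one_im, Complex.zero_im] at him
  have hprod : (a * w.im) * (w.re - 1 / 2) = 0 := by linarith
  have hx : w.re = 1 / 2 := by
    rcases mul_eq_zero.mp hprod with hy | hx
    · have hy0 : w.im = 0 := (mul_eq_zero.mp hy).resolve_left ha.ne'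
      rw [hy0] at hre
      have hsq : a * (w.re - 1 / 2) ^ 2 ≤ 0 := by linarith
      have : (w.re - 1 / 2) ^ 2 = 0 :=
        le_antisymm (nonpos_of_mul_nonpos_right hsq ha) (sq_nonneg _)
      linarith [pow_eq_zero_iff two_ne_zero |>.mp this]
    · linarith
  rw [Complex.normSq_apply]
  rw [hx] at hre ⊢
  linarith

open Complex in
/-- The Riemann hypothesis for `ζ_{F_q}` (`q = 2, 3, 4`): if `q^(1−2s) − q^(1−s) + 1 = 0`,
then `Re(s) = 1/2`. -/
theorem stmt_13 (q : ℕ) (hq : q ∈ ({2, 3, 4} : Set ℕ)) (s : ℂ)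
    (h : (q : ℂ) ^ (1 - 2 * s) - (q : ℂ) ^ (1 - s) + 1 = 0) :
    s.re = 1 / 2 := by
  have hbounds : 2 ≤ q ∧ q ≤ 4 := by
    rcases hq with rfl | rfl | rfl <;> norm_num
  have hq1 : (1 : ℝ) < q := by exact_mod_cast hbounds.1
  have hq4 : (q : ℝ) ≤ 4 := by exact_mod_cast hbounds.2
  have hq0 : (0 : ℝ) < q := by linarith
  have hqC : (q : ℂ) ≠ 0 := by exact_mod_cast hq0.ne'
  have hlin : (q : ℂ) ^ (1 - s) = q * (q : ℂ) ^ (-s) := by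
    rw [sub_eq_add_neg, cpow_add _ _ hqC, cpow_one]
  have hquad : (q : ℂ) ^ (1 - 2 * s) = q * ((q : ℂ) ^ (-s)) ^ 2 := by
    rw [show (1 - 2 * s : ℂ) = 1 + (-s + -s) by ring, cpow_add _ _ hqC, cpow_add _ _ hqC,
      cpow_one, pow_two]
  rw [hlin, hquad] at h
  have hnorm := mul_normSq_eq_one_of_quadratic_eq_zero hq0 hq4 (w := (q : ℂ) ^ (-s))
    (by simpa using h)
  rw [normSq_eq_norm_sq, ← ofReal_natCast, norm_cpow_eq_rpow_re_of_pos hq0, neg_re, pow_two,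
    ← Real.rpow_add hq0] at hnorm
  have hpow : (q : ℝ) ^ (1 + (-s.re + -s.re)) = 1 := by
    rw [Real.rpow_add hq0, Real.rpow_one, hnorm]
  have hlog := congrArg Real.log hpow
  rw [Real.log_rpow hq0, Real.log_one] at hlog
  linarith [(mul_eq_zero.mp hlog).resolve_right (Real.log_pos hq1).ne']
end

section
/- Let q ∈ {2, 3, 4}, let λ ∈ ℂ, and let T₁, …, T_q, Z₀, Z₁, C₁ ∈ ℂ with τ = T₁ + ⋯ + T_q. Suppose (i) λ·T_j = (q+1)·Z₁ for all j = 1, …, q; (ii) λ·Z₁ = τ + Z₀; (iii) λ·Z₀ = q·Z₁ + C₁; (iv) −2λ·τ = (q+1)·C₁. If not all of T₁, …, T_q, Z₀, Z₁, C₁ are zero, then λ ∈ {0, q, −q}. -/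
/-- For `q ∈ {2, 3, 4}`, a nonzero solution `(T₁, …, T_q, Z₀, Z₁, C₁)` of the eigenvalue
system `λ·T_j = (q+1)·Z₁`, `λ·Z₁ = τ + Z₀`, `λ·Z₀ = q·Z₁ + C₁`, `−2λ·τ = (q+1)·C₁`
(with `τ = T₁ + ⋯ + T_q`) forces `λ ∈ {0, q, −q}`. -/
theorem stmt_15 (q : ℕ) (hq : q ∈ ({2, 3, 4} : Set ℕ)) (lam : ℂ)
    (T : Fin q → ℂ) (Z₀ Z₁ C₁ : ℂ) (τ : ℂ) (hτ : τ = ∑ j, T j)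
    (h1 : ∀ j, lam * T j = (q + 1) * Z₁)
    (h2 : lam * Z₁ = τ + Z₀)
    (h3 : lam * Z₀ = q * Z₁ + C₁)
    (h4 : -2 * lam * τ = (q + 1) * C₁)
    (hnz : ¬((∀ j, T j = 0) ∧ Z₀ = 0 ∧ Z₁ = 0 ∧ C₁ = 0)) :
    lam ∈ ({0, (q : ℂ), -(q : ℂ)} : Set ℂ) := by
  have hq1 : (q : ℂ) + 1 ≠ 0 := Nat.cast_add_one_ne_zero q
  have hsum : lam * τ = q * ((q + 1) * Z₁) := by
    rw [hτ, Finset.mul_sum, Finset.sum_congr rfl fun j _ => h1 j]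
    simp
  have hC : C₁ = -2 * q * Z₁ := mul_left_cancel₀ hq1 (by linear_combination -h4 - 2 * hsum)
  have hZ : (lam - q) * (lam + q) * Z₁ = 0 := by
    linear_combination lam * h2 + hsum + h3 + hC
  simp only [Set.mem_insert_iff, Set.mem_singleton_iff]
  by_cases hl : lam = 0
  · exact Or.inl hl
  right
  have hZ1 : Z₁ ≠ 0 := by
    rintro rfl
    have hT : ∀ j, T j = 0 := fun j => by simpa [hl] using h1 j
    have hC0 : C₁ = 0 := by simpa using hC
    exact hnz ⟨hT, by simpa [hl, hC0] using h3, rfl, hC0⟩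
  rcases mul_eq_zero.mp ((mul_eq_zero.mp hZ).resolve_right hZ1) with h | h
  · exact Or.inl (sub_eq_zero.mp h)
  · exact Or.inr (eq_neg_of_add_eq_zero_left h)
end

section
/- Let q ∈ {2, 3, 4} and let ε ∈ {1, −1}. Set λ = ε·q. Then the solutions (T₁, …, T_q, Z₀, Z₁, C₁) ∈ ℂ^{q+3} of the system (i) λ·T_j = (q+1)·Z₁ for all j; (ii) λ·Z₁ = (T₁ + ⋯ + T_q) + Z₀; (iii) λ·Z₀ = q·Z₁ + C₁; (iv) −2λ·(T₁ + ⋯ + T_q) = (q+1)·C₁ are exactly the complex scalar multiples of the vector with T_j = q+1 for all j, Z₀ = −q, Z₁ = ε·q, C₁ = −2ε·q². In particular the solution space is one-dimensional. -/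
/-- For `q ∈ {2, 3, 4}` and `λ = ε·q` with `ε = ±1`, the solutions of the eigenvalue
system `λ·T_j = (q+1)·Z₁`, `λ·Z₁ = (T₁ + ⋯ + T_q) + Z₀`, `λ·Z₀ = q·Z₁ + C₁`,
`−2λ·(T₁ + ⋯ + T_q) = (q+1)·C₁` are exactly the complex scalar multiples of the vector
with `T_j = q+1`, `Z₀ = −q`, `Z₁ = ε·q`, `C₁ = −2ε·q²`; in particular the solution
space is one-dimensional. -/
theorem stmt_16 (q : ℕ) (hq : q ∈ ({2, 3, 4} : Set ℕ)) (ε : ℂ)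
    (hε : ε ∈ ({1, -1} : Set ℂ)) (lam : ℂ) (hlam : lam = ε * q)
    (T : Fin q → ℂ) (Z₀ Z₁ C₁ : ℂ) :
    ((∀ j, lam * T j = (q + 1) * Z₁) ∧
      lam * Z₁ = (∑ j, T j) + Z₀ ∧
      lam * Z₀ = q * Z₁ + C₁ ∧
      -2 * lam * (∑ j, T j) = (q + 1) * C₁)
    ↔ ∃ c : ℂ, (∀ j, T j = c * (q + 1)) ∧ Z₀ = c * (-q) ∧ Z₁ = c * (ε * q) ∧
        C₁ = c * (-2 * ε * q ^ 2) := by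
  have hq0 : (q : ℂ) ≠ 0 := by
    rcases hq with rfl | rfl | rfl <;> norm_num
  have hε2 : ε * ε = 1 := by
    rcases hε with rfl | rfl <;> norm_num
  subst hlam
  constructor
  · rintro ⟨hT, h2, h3, -⟩
    obtain ⟨c, rfl⟩ : ∃ c, Z₁ = c * (ε * q) :=
      ⟨ε * Z₁ / q, by field_simp; linear_combination -Z₁ * hε2⟩
    have hT' : ∀ j, T j = c * (q + 1) := fun j =>
      mul_left_cancel₀ hq0 (by
        linear_combination ε * hT j + (q * (q + 1) * c - q * T j) * hε2)
    have hZ : Z₀ = c * (-q) := by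
      simp only [hT', Finset.sum_const, Finset.card_univ, Fintype.card_fin, nsmul_eq_mul] at h2
      linear_combination -h2 + c * q ^ 2 * hε2
    refine ⟨c, hT', hZ, rfl, ?_⟩
    subst hZ
    linear_combination -h3
  · rintro ⟨c, hT, rfl, rfl, rfl⟩
    simp only [hT, Finset.sum_const, Finset.card_univ, Fintype.card_fin, nsmul_eq_mul]
    refine ⟨fun _ => by ring, ?_, by ring, by ring⟩
    linear_combination c * q ^ 2 * hε2
end
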